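/- Let n ≥ 1, k ≥ 1 and a ≥ 1 with a + k − 1 ≤ n, and let π ∈ S_n be the increasing k-cycle ⟨a, a+1, …, a+k−1⟩, i.e., in one-line notation π_j = j for j < a or j ≥ a+k, π_j = j+1 for a ≤ j ≤ a+k−2, and π_{a+k−1} = a. Then the fiber of the MVP outcome map over π has exactly k elements: |O_n^{-1}(π)| = k. -/

import Mathlib

open Finset

namespace MVPPark

/-- One step of the MVP parking process: car `c`, preferring spot `p`, arrives at the
state `state` (recording, for each spot, the car parked there, if any).  Car `c` always
parks in spot `p`; if spot `p` was occupied by an (earlier) car `j`, then `j` is bumped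
and parks in the first unoccupied spot strictly beyond `p`, if such a spot exists
(otherwise `j` drives off unparked). -/
def mvpStep {n : ℕ} (state : Fin n → Option (Fin n)) (c p : Fin n) :
    Fin n → Option (Fin n) :=
  match state p with
  | none => Function.update state p (some c)
  | some j =>
    match (List.finRange n).find? (fun k => decide (p < k) && (state k).isNone) with
    | none => Function.update state p (some c)
    | some k => Function.update (Function.update state p (some c)) k (some j)

/-- The final state of the MVP parking process with preference list `α`:
cars `0, 1, …, n-1` enter in order, car `i` preferring spot `α i`. -/
def mvpRun {n : ℕ} (α : Fin n → Fin n) : Fin n → Option (Fin n) :=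
  (List.finRange n).foldl (fun st c => mvpStep st c (α c)) (fun _ => none)

/-- `α` is an MVP parking function: under the MVP rule, all `n` cars end up parked. -/
def IsMVP {n : ℕ} (α : Fin n → Fin n) : Prop :=
  ∀ c : Fin n, ∃ j : Fin n, mvpRun α j = some c

/-- The outcome of the MVP parking process on `α` is the permutation `π`:
for each `j`, spot `j` ends up occupied by car `π j`. -/
def MvpOutcome {n : ℕ} (α : Fin n → Fin n) (π : Equiv.Perm (Fin n)) : Prop :=
  ∀ j : Fin n, mvpRun α j = some (π j)

end MVPPark

namespace MVPPark

variable {n : ℕ}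

/-- The state of the MVP parking process after the first `m` cars have entered. -/
def mvpState (α : Fin n → Fin n) (m : ℕ) : Fin n → Option (Fin n) :=
  ((List.finRange n).take m).foldl (fun st c => mvpStep st c (α c)) (fun _ => none)

lemma mvpState_zero (α : Fin n → Fin n) (j : Fin n) : mvpState α 0 j = none := by
  simp [mvpState]

lemma mvpState_self (α : Fin n → Fin n) : mvpState α n = mvpRun α := by
  rw [mvpState, mvpRun, List.take_of_length_le (by simp)]

lemma mvpState_succ (α : Fin n → Fin n) (c : Fin n) :
    mvpState α (c.1 + 1) = mvpStep (mvpState α c.1) c (α c) := by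
  rw [mvpState, List.take_succ_eq_append_getElem (by simp), List.foldl_append]
  simp [mvpState]

lemma mvpStep_cases (s : Fin n → Option (Fin n)) (c p : Fin n) :
    mvpStep s c p = Function.update s p (some c) ∨ ∃ x k, s p = some x ∧ p < k ∧
      mvpStep s c p = Function.update (Function.update s p (some c)) k (some x) := by
  cases hs : s p with
  | none => simp [mvpStep, hs]
  | some x =>
    cases hf : (List.finRange n).find? (fun k => decide (p < k) && (s k).isNone) with
    | none => simp [mvpStep, hs, hf]
    | some k =>
      have hk := List.find?_some hf
      simp only [Bool.and_eq_true, decide_eq_true_eq] at hk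
      exact Or.inr ⟨x, k, rfl, hk.1, by simp [mvpStep, hs, hf]⟩

lemma mvpStep_apply_self (s : Fin n → Option (Fin n)) (c p : Fin n) :
    mvpStep s c p p = some c := by
  obtain h | ⟨x, k, -, hk, h⟩ := mvpStep_cases s c p
  · rw [h, Function.update_self]
  · rw [h, Function.update_of_ne hk.ne, Function.update_self]

lemma mvpStep_apply_of_lt (s : Fin n → Option (Fin n)) (c : Fin n) {p j : Fin n} (hj : j < p) :
    mvpStep s c p j = s j := by
  obtain h | ⟨x, k, -, hk, h⟩ := mvpStep_cases s c p
  · rw [h, Function.update_of_ne hj.ne]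
  · rw [h, Function.update_of_ne (hj.trans hk).ne, Function.update_of_ne hj.ne]

/-- A car parked after one step was parked weakly to the left before it, unless it has just
arrived. -/
lemma mvpStep_eq_some {s : Fin n → Option (Fin n)} {c p j x : Fin n}
    (h : mvpStep s c p j = some x) : (x = c ∧ j = p) ∨ ∃ i ≤ j, s i = some x := by
  obtain h' | ⟨y, k, hy, hk, h'⟩ := mvpStep_cases s c p
  · simp only [h', Function.update_apply] at h
    grind
  · simp only [h', Function.update_apply] at h
    have := hk.le
    grind

lemma mvpStep_of_eq_none {s : Fin n → Option (Fin n)} {p : Fin n} (c : Fin n) (h : s p = none) :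
    mvpStep s c p = Function.update s p (some c) := by
  simp [mvpStep, h]

/-- A bumped car moves to the next spot if that spot is free. -/
lemma mvpStep_of_eq_some {s : Fin n → Option (Fin n)} {p q x : Fin n} (c : Fin n)
    (h : s p = some x) (hq : q.1 = p.1 + 1) (hfree : s q = none) :
    mvpStep s c p = Function.update (Function.update s p (some c)) q (some x) := by
  have hfind : (List.finRange n).find? (fun k => decide (p < k) && (s k).isNone) = some q := by
    cases hf : (List.finRange n).find? (fun k => decide (p < k) && (s k).isNone) with
    | none =>
      have := List.find?_eq_none.1 hf q (List.mem_finRange q)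
      simp [hfree, Fin.lt_def, hq] at this
    | some k =>
      rw [List.find?_eq_some_iff_getElem] at hf
      obtain ⟨hk, i, hi, rfl, hmin⟩ := hf
      simp only [List.getElem_finRange, Bool.and_eq_true, decide_eq_true_eq, Fin.lt_def,
        Fin.val_cast] at hk
      have hle : ¬ q.1 < i := fun hlt => by
        have := hmin q.1 hlt
        have hpq : p < q := by rw [Fin.lt_def]; omega
        simp [hfree, hpq] at this
      congr 1
      ext
      simp only [List.getElem_finRange, Fin.val_cast]
      omega
  simp [mvpStep, h, hfind]

lemma lt_of_mvpState_eq_some {α : Fin n → Fin n} {m : ℕ} (hm : m ≤ n) {j x : Fin n}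
    (h : mvpState α m j = some x) : x.1 < m := by
  induction m generalizing j with
  | zero => simp [mvpState_zero] at h
  | succ m ih =>
    rw [mvpState_succ α ⟨m, hm⟩] at h
    obtain ⟨rfl, -⟩ | ⟨i, -, hi⟩ := mvpStep_eq_some h
    · simp
    · exact (ih (by omega) hi).trans (by omega)

/-- At every time, each car that has entered is parked weakly to the left of its final spot. -/
lemma MvpOutcome.exists_le_symm {α : Fin n → Fin n} {π : Equiv.Perm (Fin n)}
    (h : MvpOutcome α π) {m : ℕ} (hm : m ≤ n) (c : Fin n) (hc : c.1 < m) :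
    ∃ j ≤ π.symm c, mvpState α m j = some c := by
  induction hm using Nat.decreasingInduction with
  | self => exact ⟨π.symm c, le_rfl, by rw [mvpState_self, h, Equiv.apply_symm_apply]⟩
  | of_succ m hm ih =>
    obtain ⟨j, hj, hs⟩ := ih (by omega)
    rw [mvpState_succ α ⟨m, hm⟩] at hs
    obtain ⟨rfl, -⟩ | ⟨i, hi, hi'⟩ := mvpStep_eq_some hs
    · simp at hc
    · exact ⟨i, hi.trans hj, hi'⟩

/-- No car prefers a spot beyond its final one. -/
lemma MvpOutcome.le_symm {α : Fin n → Fin n} {π : Equiv.Perm (Fin n)}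
    (h : MvpOutcome α π) (c : Fin n) : α c ≤ π.symm c := by
  obtain ⟨j, hj, hs⟩ := h.exists_le_symm (m := c.1 + 1) c.2 c (by omega)
  rw [mvpState_succ] at hs
  obtain ⟨-, rfl⟩ | ⟨i, -, hi⟩ := mvpStep_eq_some hs
  · exact hj
  · exact absurd (lt_of_mvpState_eq_some c.2.le hi) (lt_irrefl _)

/-- If an initial segment of spots has its final occupants, then the next car does not prefer
any of these spots. -/
lemma MvpOutcome.le_of_forall_lt_eq {α : Fin n → Fin n} {π : Equiv.Perm (Fin n)}
    (h : MvpOutcome α π) (c : Fin n) {l : ℕ}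
    (hl : ∀ j : Fin n, j.1 < l → mvpState α c.1 j = some (π j)) : l ≤ (α c).1 := by
  by_contra! hlt
  have hc := lt_of_mvpState_eq_some c.2.le (hl _ hlt)
  obtain ⟨j, hj, hs⟩ := h.exists_le_symm (m := c.1 + 1) c.2 (π (α c)) (by omega)
  rw [Equiv.symm_apply_apply] at hj
  rw [mvpState_succ] at hs
  obtain rfl | hj := hj.eq_or_lt
  · rw [mvpStep_apply_self, Option.some_inj] at hs
    exact hc.ne (congrArg Fin.val hs.symm)
  · rw [mvpStep_apply_of_lt _ _ hj, hl j (lt_trans (Fin.lt_def.1 hj) hlt), Option.some_inj] at hs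
    exact hj.ne (π.injective hs)

/-- `π` is the increasing cycle on the interval from `A` to `B`, in one-line notation. -/
def IsIncCycle (π : Equiv.Perm (Fin n)) (A B : Fin n) : Prop :=
  ∀ j, (π j).1 = if A ≤ j ∧ j < B then j.1 + 1 else if j = B then A.1 else j.1

lemma IsIncCycle.symm_apply {π : Equiv.Perm (Fin n)} {A B : Fin n} (hπ : IsIncCycle π A B)
    (hAB : A ≤ B) (c : Fin n) :
    (π.symm c).1 = if A < c ∧ c ≤ B then c.1 - 1 else if c = A then B.1 else c.1 := by
  have := hπ (π.symm c)
  rw [Equiv.apply_symm_apply] at this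
  simp only [Fin.lt_def, Fin.le_def, Fin.ext_iff] at *
  split_ifs at * <;> omega

lemma IsIncCycle.mvpState_eq_of_lt {π : Equiv.Perm (Fin n)} {A B : Fin n} (hπ : IsIncCycle π A B)
    (hAB : A ≤ B) {α : Fin n → Fin n} (h : MvpOutcome α π) {m : ℕ} (hm : m ≤ n) (j : Fin n)
    (hj : j.1 < if A.1 < m ∧ m ≤ B.1 then m - 1 else m) : mvpState α m j = some (π j) := by
  have hσ := hπ.symm_apply hAB
  -- once all cars of the cycle have entered, a prefix one shorter suffices
  have key : ∀ m ≤ n, (∀ j : Fin n, (j.1 < if A.1 < m then m - 1 else m) →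
      mvpState α m j = some (π j)) → ∀ j : Fin n,
      (j.1 < if A.1 < m ∧ m ≤ B.1 then m - 1 else m) → mvpState α m j = some (π j) := by
    intro m hm hw j hj
    by_cases hlt : j.1 < if A.1 < m then m - 1 else m
    · exact hw j hlt
    have hjm : j.1 + 1 = m ∧ A.1 < m ∧ B.1 < m := by split_ifs at * <;> omega
    have hpj : (π j).1 < m := by
      have := hπ j
      simp only [Fin.lt_def, Fin.le_def, Fin.ext_iff] at *
      split_ifs at * <;> omega
    obtain ⟨i, hi, hs⟩ := h.exists_le_symm hm (π j) hpj
    rw [Equiv.symm_apply_apply] at hi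
    obtain rfl | hi := hi.eq_or_lt
    · exact hs
    · rw [hw i (by rw [if_pos hjm.2.1]; rw [Fin.lt_def] at hi; omega), Option.some_inj] at hs
      exact absurd (π.injective hs) hi.ne
  refine key m hm ?_ j hj
  clear hj j
  induction m with
  | zero => intro j hj; simp at hj
  | succ m ih =>
    intro j hj
    have hpre := key m (by omega) (ih (by omega))
    have h1 := h.le_of_forall_lt_eq ⟨m, hm⟩ hpre
    have h2 := h.le_symm ⟨m, hm⟩
    have h3 := hσ ⟨m, hm⟩
    rw [mvpState_succ α ⟨m, hm⟩]
    have hjle : j ≤ α ⟨m, hm⟩ := by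
      simp only [Fin.lt_def, Fin.le_def, Fin.ext_iff] at *
      split_ifs at * <;> omega
    obtain rfl | hjlt := hjle.eq_or_lt
    · rw [mvpStep_apply_self, Option.some_inj, ← Equiv.symm_apply_eq]
      simp only [Fin.lt_def, Fin.le_def, Fin.ext_iff] at *
      split_ifs at * <;> omega
    · rw [mvpStep_apply_of_lt _ _ hjlt]
      apply hpre
      simp only [Fin.lt_def, Fin.le_def, Fin.ext_iff] at *
      split_ifs at * <;> omega

lemma IsIncCycle.eq_update {π : Equiv.Perm (Fin n)} {A B : Fin n} (hπ : IsIncCycle π A B)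
    (hAB : A ≤ B) {α : Fin n → Fin n} (h : MvpOutcome α π) :
    α A ∈ Set.Icc A B ∧ α = Function.update π.symm A (α A) := by
  have hσ := hπ.symm_apply hAB
  have hlow (c : Fin n) := h.le_of_forall_lt_eq c (fun j => hπ.mvpState_eq_of_lt hAB h c.2.le j)
  constructor
  · have h1 := hlow A
    have h2 := h.le_symm A
    have h3 := hσ A
    simp only [Set.mem_Icc, Fin.lt_def, Fin.le_def, Fin.ext_iff] at *
    split_ifs at * <;> omega
  · rw [Function.eq_update_iff]
    refine ⟨rfl, fun c hc => ?_⟩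
    have h1 := hlow c
    have h2 := h.le_symm c
    have h3 := hσ c
    simp only [ne_eq, Fin.lt_def, Fin.le_def, Fin.ext_iff] at *
    split_ifs at * <;> omega

lemma IsIncCycle.mvpState_update {π : Equiv.Perm (Fin n)} {A B p : Fin n}
    (hπ : IsIncCycle π A B) (hp : p ∈ Set.Icc A B) {m : ℕ} (hm : m ≤ n) (j : Fin n) :
    mvpState (Function.update π.symm A p) m j =
      if m ≤ A.1 ∨ B.1 < m then (if j.1 < m then some (π j) else none)
      else if j.1 < m - 1 then some (π j)
      else if j.1 = max p.1 (m - 1) then some A else none := by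
  obtain ⟨hAp, hpB⟩ := hp
  have hσ := hπ.symm_apply (hAp.trans hpB)
  induction m generalizing j with
  | zero => simp [mvpState_zero]
  | succ m ih =>
    specialize ih (by omega)
    set α := Function.update (⇑π.symm) A p with hα
    have hq : (A.1 < m ∧ m ≤ B.1 ∧ (α ⟨m, hm⟩).1 = m - 1) ∨ (m = A.1 ∧ (α ⟨m, hm⟩).1 = p.1) ∨
        ((m < A.1 ∨ B.1 < m) ∧ (α ⟨m, hm⟩).1 = m) := by
      have h3 := hσ ⟨m, hm⟩
      rw [hα, Function.update_apply]
      simp only [Fin.lt_def, Fin.le_def, Fin.ext_iff] at h3 hAp hpB ⊢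
      split_ifs at h3 ⊢ <;> omega
    have hπj : (A.1 ≤ j.1 ∧ j.1 < B.1 ∧ (π j).1 = j.1 + 1) ∨ (j.1 = B.1 ∧ (π j).1 = A.1) ∨
        ((j.1 < A.1 ∨ B.1 < j.1) ∧ (π j).1 = j.1) := by
      have h3 := hπ j
      simp only [Fin.lt_def, Fin.le_def, Fin.ext_iff] at h3 hAp hpB
      split_ifs at h3 <;> omega
    rw [mvpState_succ α ⟨m, hm⟩]
    clear_value α
    generalize α ⟨m, hm⟩ = q at hq
    rw [Fin.le_def] at hAp hpB
    by_cases hb : A.1 < m ∧ m ≤ B.1 ∧ p.1 < m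
    · have hs : mvpState α m q = some A := by
        rw [ih, if_neg (by omega), if_neg (by omega), if_pos (by omega)]
      have hs' : mvpState α m ⟨m, hm⟩ = none := by
        rw [ih, if_neg (by omega), if_neg (by simp only; omega), if_neg (by simp only; omega)]
      rw [mvpStep_of_eq_some ⟨m, hm⟩ hs (q := ⟨m, hm⟩) (by simp only; omega) hs',
        Function.update_apply, Function.update_apply, ih, if_neg (c := m ≤ A.1 ∨ _) (by omega)]
      clear hs hs' ih hα hσ
      simp only [Fin.ext_iff]
      split_ifs <;> first | rfl | omega | (simp only [Option.some_inj, Fin.ext_iff]; omega)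
    · have hs : mvpState α m q = none := by
        rw [ih]
        split_ifs <;> first | rfl | omega
      rw [mvpStep_of_eq_none ⟨m, hm⟩ hs, Function.update_apply, ih]
      clear hs ih hα hσ
      simp only [Fin.ext_iff]
      split_ifs <;> first | rfl | omega | (simp only [Option.some_inj, Fin.ext_iff]; omega)

/-- The fiber over an increasing cycle: every car prefers its final spot, except that the first
car of the cycle may prefer any spot of the cycle. -/
lemma IsIncCycle.mvpOutcome_iff {π : Equiv.Perm (Fin n)} {A B : Fin n} (hπ : IsIncCycle π A B)
    (hAB : A ≤ B) (α : Fin n → Fin n) :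
    MvpOutcome α π ↔ α ∈ Function.update (⇑π.symm) A '' Set.Icc A B := by
  constructor
  · intro h
    obtain ⟨hmem, heq⟩ := hπ.eq_update hAB h
    exact ⟨α A, hmem, heq.symm⟩
  · rintro ⟨p, hp, rfl⟩ j
    rw [← mvpState_self, hπ.mvpState_update hp le_rfl, if_pos (Or.inr B.2), if_pos j.2]

end MVPPark

open MVPPark in
/-- If `π` is the increasing `k`-cycle `⟨a, a+1, …, a+k-1⟩` (described in one-line
notation, with spots and cars numbered `1, …, n` via `j ↦ j.1 + 1`), then the fiber of
the MVP outcome map over `π` has exactly `k` elements. -/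
theorem fiber_increasing_cycle (n a k : ℕ) (hn : 1 ≤ n) (ha : 1 ≤ a) (hk : 1 ≤ k)
    (hak : a + k - 1 ≤ n) (π : Equiv.Perm (Fin n))
    (hfix : ∀ j : Fin n, (j.1 + 1 < a ∨ a + k ≤ j.1 + 1) → π j = j)
    (hup : ∀ j : Fin n, a ≤ j.1 + 1 → j.1 + 1 ≤ a + k - 2 → (π j).1 = j.1 + 1)
    (hlast : ∀ j : Fin n, j.1 + 1 = a + k - 1 → (π j).1 + 1 = a) :
    Nat.card {α : Fin n → Fin n // MvpOutcome α π} = k := by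
  let A : Fin n := ⟨a - 1, by omega⟩
  let B : Fin n := ⟨a + k - 2, by omega⟩
  have hAB : A ≤ B := by simp only [A, B, Fin.le_def]; omega
  have hπ : IsIncCycle π A B := by
    intro j
    have h1 := hfix j
    have h2 := hup j
    have h3 := hlast j
    rw [Fin.ext_iff] at h1
    simp only [A, B, Fin.le_def, Fin.lt_def, Fin.ext_iff]
    split_ifs <;> omega
  have hset : {α : Fin n → Fin n | MvpOutcome α π} =
      Function.update (⇑π.symm) A '' Set.Icc A B :=
    Set.ext (hπ.mvpOutcome_iff hAB)
  change Nat.card ↥{α : Fin n → Fin n | MvpOutcome α π} = k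
  rw [hset, Nat.card_image_of_injective (Function.update_injective _ _), Nat.card_eq_fintype_card,
    Fintype.card_Icc, Fin.card_Icc]
  simp only [A, B]
  omega
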